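/- For every k ≥ 2, MLR is not linearly Medvedev reducible to Some(MLR, k): there is no linear reduction Φ such that Φ^X ∈ MLR for every X ∈ Some(MLR, k). -/

import Mathlib

open MeasureTheory

/-- Cantor space `2^ω`: functions from `ℕ` to `Bool`. -/
abbrev Cantor : Type := ℕ → Bool

/-- The fair-coin product measure on Cantor space (each bit is `true` with probability 1/2,
independently), realized concretely as the pushforward of Lebesgue measure on `[0,1)`
under the binary-digit map `x ↦ (n ↦ n-th binary digit of x)`. -/
noncomputable def fairCoin : Measure Cantor :=
  Measure.map (fun (x : ℝ) (n : ℕ) => decide ((⌊x * 2 ^ (n + 1)⌋ % 2 : ℤ) = 1))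
    (volume.restrict (Set.Ico (0 : ℝ) 1))

/-- The cylinder `[σ]` of all `X ∈ 2^ω` extending the finite binary string `σ`. -/
def cylinder (σ : List Bool) : Set Cantor :=
  {X | ∀ (i : ℕ) (h : i < σ.length), X i = σ.get ⟨i, h⟩}

/-- The `n`-th level `U_n` of a test `U`: the union of the cylinders enumerated by `U n`. -/
def testSet (U : ℕ → ℕ → Option (List Bool)) (n : ℕ) : Set Cantor :=
  ⋃ σ ∈ {σ : List Bool | ∃ k, U n k = some σ}, cylinder σ

/-- A Martin-Löf test: a computable enumeration of cylinders with `μ(U_n) ≤ 2^{-n}`. -/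
def MLTest (U : ℕ → ℕ → Option (List Bool)) : Prop :=
  Computable₂ U ∧ ∀ n, fairCoin (testSet U n) ≤ ((2 : ENNReal) ^ n)⁻¹

/-- The Martin-Löf random elements of Cantor space. -/
def MLR : Set Cantor :=
  {X | ∀ U : ℕ → ℕ → Option (List Bool), MLTest U → ∃ n, X ∉ testSet U n}

/-- The `i`-th of `k` interleaved columns of `X`: `X_i(n) = X(k·n + i)`. -/
def colK (k : ℕ) (X : Cantor) (i : ℕ) : Cantor := fun n => X (k * n + i)

/-- `Some(C, k)`: some column `i < k` is in `C`. -/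
def SomeK (C : Set Cantor) (k : ℕ) : Set Cantor := {X | ∃ i < k, colK k X i ∈ C}

/-- The output `Φ^X` of the linear reduction given by query positions `q n` (distinct) and
constants `b n`: `Φ^X(n) = b n + Σ_{i ∈ q n} X(i)` with addition mod 2 (XOR). -/
def linEval (q : ℕ → List ℕ) (b : ℕ → Bool) (X : Cantor) : Cantor :=
  fun n => (q n).foldl (fun acc i => xor acc (X i)) (b n)

/-- Binary digits of a real. -/
noncomputable def dig (x : ℝ) (n : ℕ) : Bool := decide ((⌊x * 2 ^ (n + 1)⌋ % 2 : ℤ) = 1)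

theorem measurable_dig : Measurable dig := by
  refine measurable_pi_lambda _ fun n => ?_
  have h1 : Measurable (fun m : ℤ => decide ((m % 2 : ℤ) = 1)) := Measurable.of_discrete
  have h2 : Measurable (fun x : ℝ => ⌊x * 2 ^ (n + 1)⌋) :=
    Int.measurable_floor.comp (measurable_id.mul_const _)
  exact h1.comp h2

theorem fairCoin_eq : fairCoin = Measure.map dig (volume.restrict (Set.Ico (0 : ℝ) 1)) := rfl

theorem fairCoin_apply {A : Set Cantor} (hA : MeasurableSet A) :
    fairCoin A = volume (dig ⁻¹' A ∩ Set.Ico (0 : ℝ) 1) := by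
  rw [fairCoin_eq, Measure.map_apply measurable_dig hA,
    Measure.restrict_apply (measurable_dig hA)]

theorem fairCoin_univ : fairCoin Set.univ = 1 := by
  rw [fairCoin_apply MeasurableSet.univ]; simp

/-- Floors at coarser scale. -/
theorem floor_coarse (x : ℝ) (t j : ℕ) (hj : j ≤ t) :
    ⌊x * 2 ^ (j + 1)⌋ = ⌊x * 2 ^ (t + 1)⌋ / (2 : ℤ) ^ (t - j) := by
  have h : x * 2 ^ (j + 1) = (x * 2 ^ (t + 1)) / ((2 ^ (t - j) : ℕ) : ℝ) := by
    have : (2 : ℝ) ^ (t + 1) = 2 ^ (j + 1) * 2 ^ (t - j) := by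
      rw [← pow_add]; congr 1; omega
    rw [this]; push_cast; field_simp
  rw [h, Int.floor_div_natCast]
  push_cast; rfl

theorem floor_shift (x : ℝ) (t : ℕ) :
    ⌊(x + (2 ^ (t + 1))⁻¹) * 2 ^ (t + 1)⌋ = ⌊x * 2 ^ (t + 1)⌋ + 1 := by
  have : (x + (2 ^ (t + 1))⁻¹) * 2 ^ (t + 1) = x * 2 ^ (t + 1) + 1 := by
    field_simp
  rw [this, Int.floor_add_one]

theorem div_even_succ (m : ℤ) (hm : m % 2 = 0) (s : ℕ) (hs : 0 < s) :
    (m + 1) / (2 : ℤ) ^ s = m / 2 ^ s := by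
  obtain ⟨s, rfl⟩ := Nat.exists_eq_succ_of_ne_zero hs.ne'
  rw [Nat.succ_eq_add_one, pow_succ', ← Int.ediv_ediv_of_nonneg (by norm_num),
    ← Int.ediv_ediv_of_nonneg (by norm_num)]
  congr 1
  omega

theorem mem_Ico_iff_floor (x : ℝ) (t : ℕ) :
    x ∈ Set.Ico (0 : ℝ) 1 ↔ ⌊x * 2 ^ (t + 1)⌋ / (2 : ℤ) ^ (t + 1) = 0 := by
  have h : x = (x * 2 ^ (t + 1)) / ((2 ^ (t + 1) : ℕ) : ℝ) := by
    push_cast; field_simp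
  have h2 : ⌊x⌋ = ⌊x * 2 ^ (t + 1)⌋ / (2 : ℤ) ^ (t + 1) := by
    conv_lhs => rw [h]
    rw [Int.floor_div_natCast]; push_cast; rfl
  rw [← h2, Int.floor_eq_zero_iff]

/-- Cylinder on a finite set of positions. -/
def agree (T : Finset ℕ) (z : ℕ → Bool) : Set Cantor := {Y | ∀ i ∈ T, Y i = z i}

theorem measurableSet_agree (T : Finset ℕ) (z : ℕ → Bool) : MeasurableSet (agree T z) := by
  have : agree T z = ⋂ i ∈ T, (fun Y : Cantor => Y i) ⁻¹' {z i} := by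
    ext Y; simp [agree]
  rw [this]
  exact Finset.measurableSet_biInter _ fun i _ => measurable_pi_apply i (measurableSet_singleton _)

theorem shift_preimage (T : Finset ℕ) (z : ℕ → Bool) (t : ℕ) (hT : ∀ x ∈ T, x < t) :
    (fun x : ℝ => x + (2 ^ (t + 1))⁻¹) ⁻¹'
      (dig ⁻¹' (agree T z ∩ {Y | Y t = true}) ∩ Set.Ico (0 : ℝ) 1) =
      dig ⁻¹' (agree T z ∩ {Y | Y t = false}) ∩ Set.Ico (0 : ℝ) 1 := by
  ext x
  simp only [Set.mem_preimage, Set.mem_inter_iff, Set.mem_ofPred_eq, mem_Ico_iff_floor _ t,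
    floor_shift]
  have e1 : dig (x + (2 ^ (t + 1))⁻¹) t = true ↔ dig x t = false := by
    simp only [dig, floor_shift, decide_eq_true_eq, decide_eq_false_iff_not]
    omega
  rw [e1]
  by_cases hx : dig x t = false
  · have hm : ⌊x * 2 ^ (t + 1)⌋ % 2 = 0 := by
      simp only [dig, decide_eq_false_iff_not] at hx; omega
    have e2 : ∀ j < t, dig (x + (2 ^ (t + 1))⁻¹) j = dig x j := by
      intro j hj
      simp only [dig]
      rw [floor_coarse _ t j hj.le, floor_coarse x t j hj.le, floor_shift,
        div_even_succ _ hm _ (by omega)]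
    rw [div_even_succ _ hm _ (by omega)]
    have e3 : dig (x + (2 ^ (t + 1))⁻¹) ∈ agree T z ↔ dig x ∈ agree T z := by
      simp only [agree, Set.mem_ofPred_eq]
      refine forall₂_congr fun i hi => ?_
      rw [e2 i (hT i hi)]
    rw [e3]
  · simp [hx]

theorem fairCoin_agree (T : Finset ℕ) (z : ℕ → Bool) :
    fairCoin (agree T z) = ((2 : ENNReal) ^ T.card)⁻¹ := by
  induction T using Finset.induction_on_max with
  | empty =>
    have : agree ∅ z = Set.univ := by ext; simp [agree]
    rw [this, fairCoin_univ]; simp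
  | insert t T hT ih =>
    have hmt : ∀ c : Bool, MeasurableSet {Y : Cantor | Y t = c} := fun c =>
      measurableSet_eq_fun (measurable_pi_apply t) measurable_const
    have hms := measurableSet_agree T z
    have heq : fairCoin (agree T z ∩ {Y | Y t = true}) =
        fairCoin (agree T z ∩ {Y | Y t = false}) := by
      rw [fairCoin_apply (hms.inter (hmt _)), fairCoin_apply (hms.inter (hmt _)),
        ← shift_preimage T z t hT, measure_preimage_add_right]
    have hsum : fairCoin (agree T z) = fairCoin (agree T z ∩ {Y | Y t = true}) +
        fairCoin (agree T z ∩ {Y | Y t = false}) := by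
      rw [← measure_inter_add_sdiff (agree T z) (hmt true)]
      congr 2
      ext Y; simp
    have hall : ∀ c : Bool, 2 * fairCoin (agree T z ∩ {Y | Y t = c}) = fairCoin (agree T z) := by
      intro c
      cases c
      · rw [hsum, heq, two_mul]
      · rw [hsum, ← heq, two_mul]
    have hins : agree (insert t T) z = agree T z ∩ {Y | Y t = z t} := by
      ext Y; simp [agree, and_comm]
    have hnot : t ∉ T := fun h => lt_irrefl _ (hT t h)
    rw [hins, Finset.card_insert_of_notMem hnot, pow_succ', ENNReal.mul_inv (by simp) (by simp),
      ← ih, ← hall (z t), ← mul_assoc, ENNReal.inv_mul_cancel (by simp) (by simp), one_mul]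

theorem countable_tests : {U : ℕ → ℕ → Option (List Bool) | MLTest U}.Countable := by
  let F : {U : ℕ → ℕ → Option (List Bool) // MLTest U} → {f : ℕ → ℕ // Computable f} :=
    fun U => ⟨fun n => Encodable.encode (U.1 n.unpair.1 n.unpair.2),
      Computable.encode.comp (U.2.1.comp
        (Computable.fst.comp Computable.unpair) (Computable.snd.comp Computable.unpair))⟩
  have hF : Function.Injective F := by
    intro U V h
    have h1 := congrArg Subtype.val h
    apply Subtype.ext
    funext n m
    have h2 := congrFun h1 (Nat.pair n m)
    simpa [F] using h2
  exact hF.countable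

theorem exists_MLR : ∃ R : Cantor, R ∈ MLR := by
  by_contra hne
  push Not at hne
  have hcov : (Set.univ : Set Cantor) ⊆
      ⋃ U ∈ {U : ℕ → ℕ → Option (List Bool) | MLTest U}, ⋂ n, testSet U n := by
    intro X _
    have := hne X
    simp only [MLR, Set.mem_ofPred_eq, not_forall, not_exists, not_not] at this
    obtain ⟨U, hU, h⟩ := this
    simp only [Set.mem_iUnion, Set.mem_iInter]
    exact ⟨U, hU, h⟩
  have hnull : fairCoin (⋃ U ∈ {U : ℕ → ℕ → Option (List Bool) | MLTest U},
      ⋂ n, testSet U n) = 0 := by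
    rw [measure_biUnion_null_iff countable_tests]
    intro U hU
    have hb : ∀ n, fairCoin (⋂ n, testSet U n) ≤ ((2 : ENNReal)⁻¹) ^ n := fun n =>
      (measure_mono (Set.iInter_subset _ n)).trans ((hU.2 n).trans_eq ENNReal.inv_pow)
    have hlim := ENNReal.tendsto_pow_atTop_nhds_zero_of_lt_one
      (r := (2 : ENNReal)⁻¹) (by simp)
    exact le_antisymm (ge_of_tendsto' hlim hb) (by simp)
  have := measure_mono (μ := fairCoin) hcov
  rw [hnull, fairCoin_univ] at this
  simp at this

/-- Check whether a string agrees with `z` at the first `n` positions listed by `s`. -/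
def chk (s : ℕ → ℕ) (z : ℕ → Bool) (σ : List Bool) (n : ℕ) : Bool :=
  Nat.rec (motive := fun _ => Bool) true
    (fun i ok => ok && decide (σ[s i]? = some (z i))) n

theorem chk_iff (s : ℕ → ℕ) (z : ℕ → Bool) (σ : List Bool) (n : ℕ) :
    chk s z σ n = true ↔ ∀ i < n, σ[s i]? = some (z i) := by
  induction n with
  | zero => simp [chk]
  | succ n ih =>
    have : chk s z σ (n + 1) = (chk s z σ n && decide (σ[s n]? = some (z n))) := rfl
    rw [this, Bool.and_eq_true, ih, decide_eq_true_eq]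
    constructor
    · rintro ⟨h1, h2⟩ i hi
      rcases Nat.lt_succ_iff_lt_or_eq.1 hi with h | rfl
      · exact h1 i h
      · exact h2
    · intro h
      exact ⟨fun i hi => h i (by omega), h n (by omega)⟩

theorem chk_comp {s : ℕ → ℕ} {z : ℕ → Bool} (hs : Computable s) (hz : Computable z) :
    Computable₂ (chk s z) := by
  have hstep : Computable₂ (fun (p : List Bool × ℕ) (r : ℕ × Bool) =>
      r.2 && decide (p.1[s r.1]? = some (z r.1))) := by
    have hr1 : Computable (fun a : (List Bool × ℕ) × (ℕ × Bool) => a.2.1) :=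
      Computable.fst.comp Computable.snd
    have h1 : Computable (fun a : (List Bool × ℕ) × (ℕ × Bool) => a.1.1[s a.2.1]?) :=
      Computable.list_getElem?.comp (Computable.fst.comp Computable.fst) (hs.comp hr1)
    have h2 : Computable (fun a : (List Bool × ℕ) × (ℕ × Bool) => some (z a.2.1)) :=
      Computable.option_some.comp (hz.comp hr1)
    have h3 : Computable (fun a : (List Bool × ℕ) × (ℕ × Bool) =>
        decide (a.1.1[s a.2.1]? = some (z a.2.1))) :=
      (Primrec.eq (α := Option Bool)).decide.to_comp.comp h1 h2
    exact Primrec.and.to_comp.comp (Computable.snd.comp Computable.snd) h3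
  exact Computable.nat_rec (f := fun p : List Bool × ℕ => p.2) Computable.snd
    (Computable.const true) hstep

/-- A real agreeing with a computable function along a computable injective sequence of
positions is not random. -/
theorem not_MLR_of_agree {s : ℕ → ℕ} {z : ℕ → Bool} (hs : Computable s) (hz : Computable z)
    (hinj : Function.Injective s) {Y : Cantor} (hY : ∀ i, Y (s i) = z i) : Y ∉ MLR := by
  intro hR
  let U : ℕ → ℕ → Option (List Bool) := fun n m =>
    (Encodable.decode (α := List Bool) m).bind fun σ => cond (chk s z σ n) (some σ) none
  have hUc : Computable₂ U := by
    refine Computable.option_bind (f := fun p : ℕ × ℕ => Encodable.decode (α := List Bool) p.2)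
      (g := fun (p : ℕ × ℕ) (σ : List Bool) => cond (chk s z σ p.1) (some σ) none)
      (Computable.decode.comp Computable.snd) ?_
    exact Computable.cond ((chk_comp hs hz).comp Computable.snd (Computable.fst.comp Computable.fst))
      (Computable.option_some.comp Computable.snd) (Computable.const none)
  have hU : ∀ n (σ : List Bool), (∃ m, U n m = some σ) ↔ ∀ i < n, σ[s i]? = some (z i) := by
    intro n σ
    rw [← chk_iff]
    constructor
    · rintro ⟨m, hm⟩
      simp only [U, Option.bind_eq_some_iff] at hm
      obtain ⟨τ, _, h⟩ := hm
      cases hc : chk s z τ n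
      · simp [hc] at h
      · simp only [hc, cond_true, Option.some.injEq] at h
        rw [← h, hc]
    · intro h
      exact ⟨Encodable.encode σ, by simp [U, h]⟩
  have hsub : ∀ n, testSet U n ⊆ agree ((Finset.range n).image s) (Function.extend s z fun _ => true) := by
    intro n X hX
    simp only [testSet, Set.mem_iUnion, Set.mem_ofPred_eq, hU] at hX
    obtain ⟨σ, hσ, hc⟩ := hX
    intro j hj
    obtain ⟨i, hi, rfl⟩ := Finset.mem_image.1 hj
    rw [hinj.extend_apply]
    obtain ⟨hl, he⟩ := List.getElem?_eq_some_iff.1 (hσ i (Finset.mem_range.1 hi))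
    rw [hc _ hl, ← he]; rfl
  have hT : MLTest U := by
    refine ⟨hUc, fun n => (measure_mono (hsub n)).trans ?_⟩
    rw [fairCoin_agree, Finset.card_image_of_injective _ hinj, Finset.card_range]
  obtain ⟨n, hn⟩ := hR U hT
  apply hn
  let L := (Finset.range n).sup s + 1
  simp only [testSet, Set.mem_iUnion, Set.mem_ofPred_eq, hU]
  refine ⟨(List.range L).map Y, ?_, ?_⟩
  · intro i hi
    have : s i < L := Nat.lt_succ_of_le (Finset.le_sup (f := s) (Finset.mem_range.2 hi))
    simp [this, hY]
  · intro i hi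
    simp

theorem linEval_congr {q : ℕ → List ℕ} {b : ℕ → Bool} {X Y : Cantor} {n : ℕ}
    (h : ∀ p ∈ q n, X p = Y p) : linEval q b X n = linEval q b Y n := by
  unfold linEval
  exact List.foldl_ext _ _ _ fun a p hp => by rw [h p hp]

theorem foldl_xor_not (X : Cantor) (l : List ℕ) (c : Bool) :
    l.foldl (fun acc i => xor acc (X i)) (!c) = !(l.foldl (fun acc i => xor acc (X i)) c) := by
  induction l generalizing c with
  | nil => rfl
  | cons a l ih => simp only [List.foldl_cons, Bool.not_xor, ih]

theorem foldl_xor_flip (X : Cantor) (l : List ℕ) (hl : l.Nodup) (p : ℕ) (hp : p ∈ l) (c : Bool) :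
    l.foldl (fun acc i => xor acc (Function.update X p (!X p) i)) c =
      !(l.foldl (fun acc i => xor acc (X i)) c) := by
  induction l generalizing c with
  | nil => simp at hp
  | cons a l ih =>
    obtain ⟨ha, hl⟩ := List.nodup_cons.1 hl
    by_cases hap : p = a
    · subst hap
      simp only [List.foldl_cons, Function.update_self, Bool.xor_not]
      rw [← foldl_xor_not]
      refine List.foldl_ext _ _ _ fun c i hi => ?_
      rw [Function.update_of_ne (show i ≠ p by rintro rfl; exact ha hi)]
    · have hpl : p ∈ l := (List.mem_cons.1 hp).resolve_left hap
      simp only [List.foldl_cons]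
      rw [ih hl hpl, Function.update_of_ne (Ne.symm hap)]

/-- One more than the largest `P`-position in a list. -/
def top (P : ℕ → Bool) (l : List ℕ) : ℕ :=
  l.foldl (fun a p => cond (P p) (max a (p + 1)) a) 0

theorem top_prim {P : ℕ → Bool} (hP : Primrec P) : Primrec (top P) := by
  refine Primrec.list_foldl (f := fun l : List ℕ => l) (g := fun _ => 0)
    (h := fun _ (r : ℕ × ℕ) => cond (P r.2) (max r.1 (r.2 + 1)) r.1) Primrec.id (Primrec.const 0) ?_
  have h1 : Primrec (fun a : List ℕ × (ℕ × ℕ) => a.2.1) := Primrec.fst.comp Primrec.snd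
  have h2 : Primrec (fun a : List ℕ × (ℕ × ℕ) => a.2.2) := Primrec.snd.comp Primrec.snd
  exact Primrec.cond (hP.comp h2) (Primrec.nat_max.comp h1 (Primrec.succ.comp h2)) h1

theorem top_spec (P : ℕ → Bool) (l : List ℕ) :
    (∀ p ∈ l, P p = true → p < top P l) ∧
      (0 < top P l → ∃ p ∈ l, P p = true ∧ top P l = p + 1) := by
  unfold top
  induction l using List.reverseRecOn with
  | nil => simp
  | append_singleton l a ih =>
    simp only [List.foldl_append, List.foldl_cons, List.foldl_nil]
    set t := l.foldl (fun a p => cond (P p) (max a (p + 1)) a) 0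
    obtain ⟨ih1, ih2⟩ := ih
    cases ha : P a
    · simp only [cond_false]
      refine ⟨?_, fun h => ?_⟩
      · intro p hp hP
        rcases List.mem_append.1 hp with h | h
        · exact ih1 p h hP
        · rw [List.mem_singleton.1 h, ha] at hP; simp at hP
      · obtain ⟨p, hp, h⟩ := ih2 h
        exact ⟨p, List.mem_append_left _ hp, h⟩
    · simp only [cond_true]
      refine ⟨?_, fun h => ?_⟩
      · intro p hp hP
        rcases List.mem_append.1 hp with h | h
        · exact lt_max_of_lt_left (ih1 p h hP)
        · rw [List.mem_singleton.1 h]; exact lt_max_of_lt_right (Nat.lt_succ_self _)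
      · rcases le_total t (a + 1) with h' | h'
        · exact ⟨a, by simp, ha, max_eq_right h'⟩
        · obtain ⟨p, hp, h1, h2⟩ := ih2 (by omega)
          exact ⟨p, List.mem_append_left _ hp, h1, (max_eq_left h').trans h2⟩

/-- An unbounded computable function is strictly increasing along a computable sequence. -/
theorem exists_seq {m : ℕ → ℕ} (hm : Computable m) (hunb : ∀ B, ∃ n, B < m n) :
    ∃ s : ℕ → ℕ, Computable s ∧ StrictMono (fun i => m (s i)) ∧ ∀ i, 0 < m (s i) := by
  let f : ℕ → ℕ := fun B => Nat.find (hunb B)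
  have hf : ∀ B, B < m (f B) := fun B => Nat.find_spec (hunb B)
  have hfc : Computable f := by
    have hd : Computable₂ (fun B n : ℕ => decide (B < m n)) :=
      Primrec.nat_lt.decide.to_comp.comp Computable.fst (hm.comp Computable.snd)
    have h := Partrec.rfind (p := fun B n => (Part.some (decide (B < m n)))) hd.partrec₂
    refine h.of_eq fun B => ?_
    apply Part.eq_some_iff.2
    refine Nat.mem_rfind.2 ⟨by simpa using hf B, fun {j} hj => ?_⟩
    have := Nat.find_min (hunb B) hj
    simpa using this
  let s : ℕ → ℕ := fun i => Nat.rec (motive := fun _ => ℕ) (f 0) (fun _ r => f (m r)) i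
  have hss : ∀ i, s (i + 1) = f (m (s i)) := fun i => rfl
  refine ⟨s, ?_, ?_, ?_⟩
  · exact Computable.nat_rec (f := fun i : ℕ => i) (g := fun _ : ℕ => f 0)
      (h := fun (_ : ℕ) (r : ℕ × ℕ) => f (m r.2)) Computable.id
      (Computable.const _) (hfc.comp (hm.comp (Computable.snd.comp Computable.snd)))
  · exact strictMono_nat_of_lt_succ fun i => by rw [hss]; exact hf _
  · intro i
    cases i with
    | zero => exact hf 0
    | succ i => rw [hss]; exact lt_of_le_of_lt (Nat.zero_le _) (hf _)

/-- If the `P`-positions queried are unbounded, any `V` can be modified on `P`-positions so that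
the output is not random. -/
theorem kill {q : ℕ → List ℕ} (b : ℕ → Bool) (hq : Computable q) (hnd : ∀ n, (q n).Nodup)
    {P : ℕ → Bool} (hP : Primrec P) (hunb : ∀ B, ∃ n, B < top P (q n)) (V : Cantor) :
    ∃ X : Cantor, (∀ p, P p = false → X p = V p) ∧ linEval q b X ∉ MLR := by
  obtain ⟨s, hsc, hmono, hpos⟩ := exists_seq (m := fun n => top P (q n))
    ((top_prim hP).to_comp.comp hq) hunb
  choose p hpq hpP hpt using fun i => (top_spec P (q (s i))).2 (hpos i)
  have hpmono : StrictMono p := fun i j hij => by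
    have := hmono hij
    simp only [hpt] at this
    omega
  let W : ℕ → Cantor := fun i => Nat.rec (motive := fun _ => Cantor) V
    (fun i Y => if linEval q b Y (s i) = true then Function.update Y (p i) (!Y (p i)) else Y) i
  have hW : ∀ i, W (i + 1) = if linEval q b (W i) (s i) = true then
      Function.update (W i) (p i) (!W i (p i)) else W i := fun i => rfl
  have hWz : ∀ i, linEval q b (W (i + 1)) (s i) = false := by
    intro i
    rw [hW]
    split_ifs with h
    · have := foldl_xor_flip (W i) (q (s i)) (hnd _) (p i) (hpq i) (b (s i))
      unfold linEval at h ⊢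
      rw [this, h]; rfl
    · simpa using h
  have hWne : ∀ i x, x ≠ p i → W (i + 1) x = W i x := by
    intro i x hx
    rw [hW]
    split_ifs
    · rw [Function.update_of_ne hx]
    · rfl
  have hWV : ∀ i x, P x = false → W i x = V x := by
    intro i x hx
    induction i with
    | zero => rfl
    | succ i ih =>
      rw [hWne i x (fun h => by rw [h, hpP] at hx; simp at hx), ih]
  have hWstab : ∀ i j x, x < p i → W (i + j) x = W i x := by
    intro i j x hx
    induction j with
    | zero => rfl
    | succ j ih =>
      rw [← add_assoc, hWne _ x, ih]
      exact (lt_of_lt_of_le hx (hpmono.monotone (Nat.le_add_right i j))).ne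
  let X : Cantor := fun x => W (x + 1) x
  have hX : ∀ i x, x < p i → X x = W i x := by
    intro i x hx
    have hx1 : x < p (x + 1) := lt_of_lt_of_le (Nat.lt_succ_self x) (hpmono.le_apply)
    rcases le_total i (x + 1) with h | h
    · obtain ⟨j, hj⟩ := Nat.exists_eq_add_of_le h
      change W (x + 1) x = _
      rw [hj, hWstab i j x hx]
    · obtain ⟨j, hj⟩ := Nat.exists_eq_add_of_le h
      rw [hj, hWstab _ j x hx1]
  refine ⟨X, fun x hx => hWV (x + 1) x hx, ?_⟩
  have hinj : Function.Injective s := fun i j h =>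
    hmono.injective (by simp only [h])
  refine not_MLR_of_agree (s := s) (z := fun _ => false) hsc (Computable.const _) hinj fun i => ?_
  rw [← hWz i]
  refine linEval_congr fun x hx => ?_
  cases hPx : P x
  · rw [hWV (i + 1) x hPx]; exact hWV (x + 1) x hPx
  · refine hX (i + 1) x ?_
    have h1 := (top_spec P (q (s i))).1 x hx hPx
    rw [hpt] at h1
    have h2 := hpmono (Nat.lt_succ_self i)
    rw [Nat.succ_eq_add_one] at h2
    omega

/-- If all queried positions are bounded, the output is computable. -/
theorem bounded_case {q : ℕ → List ℕ} {b : ℕ → Bool} (hq : Computable q) (hb : Computable b)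
    (N : ℕ) (hN : ∀ n, ∀ p ∈ q n, p < N) (X : Cantor) : linEval q b X ∉ MLR := by
  let L : List Bool := (List.range N).map X
  let Z : Cantor := fun i => L.getD i false
  have hZ : Primrec Z := (Primrec.list_getD false).comp (Primrec.const L) Primrec.id
  have hfold : Primrec (fun a : List ℕ × Bool => a.1.foldl (fun acc i => xor acc (Z i)) a.2) := by
    refine Primrec.list_foldl (f := fun a : List ℕ × Bool => a.1) (g := fun a => a.2)
      (h := fun _ (r : Bool × ℕ) => xor r.1 (Z r.2)) Primrec.fst Primrec.snd ?_
    exact (Primrec.dom_finite (fun p : Bool × Bool => xor p.1 p.2)).comp (Primrec.pair (Primrec.fst.comp Primrec.snd) (hZ.comp (Primrec.snd.comp Primrec.snd)))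
  have hc : Computable (linEval q b Z) := hfold.to_comp.comp (hq.pair hb)
  have he : linEval q b X = linEval q b Z := by
    funext n
    refine linEval_congr fun p hp => ?_
    simp [Z, L, hN n p hp]
  rw [he]
  exact not_MLR_of_agree (s := id) Computable.id hc Function.injective_id fun i => rfl

/-- For every `k ≥ 2`, MLR is not linearly Medvedev reducible to `Some(MLR, k)`. -/
theorem mlr_not_le_sl_someK_mlr (k : ℕ) (hk : 2 ≤ k) :
    ¬ ∃ (q : ℕ → List ℕ) (b : ℕ → Bool),
      Computable q ∧ Computable b ∧ (∀ n, (q n).Nodup) ∧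
      ∀ X ∈ SomeK MLR k, linEval q b X ∈ MLR := by
  rintro ⟨q, b, hq, hb, hnd, H⟩
  obtain ⟨R, hR⟩ := exists_MLR
  have hk0 : 0 < k := by omega
  let V : Cantor := fun p => R (p / k)
  have hP : Primrec (fun p : ℕ => decide (p % k = 0)) :=
    (Primrec.eq (α := ℕ)).decide.comp (Primrec.nat_mod.comp Primrec.id (Primrec.const k))
      (Primrec.const 0)
  have hP' : Primrec (fun p : ℕ => !decide (p % k = 0)) := Primrec.not.comp hP
  have hcol : ∀ (X : Cantor) (i : ℕ), i < k → (∀ n, X (k * n + i) = V (k * n + i)) →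
      X ∈ SomeK MLR k := by
    intro X i hi h
    refine ⟨i, hi, ?_⟩
    have : colK k X i = R := by
      funext n
      simp only [colK, h, V]
      rw [Nat.mul_add_div hk0, Nat.div_eq_of_lt hi, add_zero]
    rw [this]; exact hR
  by_cases h1 : ∀ B, ∃ n, B < top (fun p : ℕ => decide (p % k = 0)) (q n)
  · obtain ⟨X, hX, hn⟩ := kill b hq hnd hP h1 V
    refine hn (H X (hcol X 1 (by omega) fun n => hX _ ?_))
    simp [Nat.mul_add_mod, Nat.mod_eq_of_lt (show 1 < k by omega)]
  by_cases h2 : ∀ B, ∃ n, B < top (fun p : ℕ => !decide (p % k = 0)) (q n)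
  · obtain ⟨X, hX, hn⟩ := kill b hq hnd hP' h2 V
    refine hn (H X (hcol X 0 (by omega) fun n => hX _ ?_))
    simp
  push Not at h1 h2
  obtain ⟨B1, h1⟩ := h1
  obtain ⟨B2, h2⟩ := h2
  refine bounded_case hq hb (max B1 B2) (fun n p hp => ?_) V (H V (hcol V 0 hk0 fun n => rfl))
  by_cases hpk : p % k = 0
  · have := (top_spec (fun p : ℕ => decide (p % k = 0)) (q n)).1 p hp (by simp [hpk])
    exact lt_max_of_lt_left (lt_of_lt_of_le this (h1 n))
  · have := (top_spec (fun p : ℕ => !decide (p % k = 0)) (q n)).1 p hp (by simp [hpk])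
    exact lt_max_of_lt_right (lt_of_lt_of_le this (h2 n))
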